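/- Let d ≥ 1 and k ≥ 0 be integers, let L > 0, and let f : [0,1]^d → ℝ be L-Lipschitz. Then for every x ∈ [0,1]^d, |(∫_{[0,1]^d} K_k^{uf}(0,|z−x|) f(z) dz) / (∫_{[0,1]^d} K_k^{uf}(0,|z−x|) dz) − f(x)| ≤ (L·d·2^{2d+1}/3)·(1 − 1/(3d))^k. -/

import Mathlib

open MeasureTheory Finset

/-- `φ_k(y) = 1 - y ∑_{j<k} (-ln y)^j / j!` for `y ∈ (0,1]`, and `φ_k(0) = 1`. -/
noncomputable def phiUF (k : ℕ) (y : ℝ) : ℝ :=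
  if y = 0 then 1
  else 1 - y * ∑ j ∈ Finset.range k, (-Real.log y) ^ j / (Nat.factorial j)

/-- The uniform connection function `K_k^uf(0, x)` on `[0,1]^d`. -/
noncomputable def Kuf (d k : ℕ) (x : Fin d → ℝ) : ℝ :=
  ∑ p ∈ Finset.univ.filter (fun p : Fin d → Fin (k + 1) => ∑ j, (p j : ℕ) = k),
    ((Nat.factorial k : ℝ) / ∏ j, (Nat.factorial (p j : ℕ) : ℝ)) * (1 / d) ^ k *
      ∏ m, phiUF (p m : ℕ) (x m)

theorem phiUF_eq (k : ℕ) (y : ℝ) :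
    phiUF k y = 1 - y * ∑ j ∈ Finset.range k, (-Real.log y) ^ j / (Nat.factorial j) := by
  unfold phiUF
  split_ifs with h <;> simp [h]

theorem phiUF_succ (k : ℕ) (y : ℝ) :
    phiUF (k + 1) y = phiUF k y - y * ((-Real.log y) ^ k / (Nat.factorial k)) := by
  simp only [phiUF_eq, Finset.sum_range_succ]
  ring

theorem phiUF_le_one (k : ℕ) {y : ℝ} (hy : y ∈ Set.Icc (0 : ℝ) 1) : phiUF k y ≤ 1 := by
  have hlog : 0 ≤ -Real.log y := neg_nonneg.mpr (Real.log_nonpos hy.1 hy.2)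
  have hs : 0 ≤ y * ∑ j ∈ Finset.range k, (-Real.log y) ^ j / (Nat.factorial j) :=
    mul_nonneg hy.1 (Finset.sum_nonneg fun j _ => by positivity)
  rw [phiUF_eq]
  linarith

theorem phiUF_nonneg (k : ℕ) {y : ℝ} (hy : y ∈ Set.Icc (0 : ℝ) 1) : 0 ≤ phiUF k y := by
  rcases hy.1.eq_or_lt with rfl | hpos
  · simp [phiUF_eq]
  have hlog : 0 ≤ -Real.log y := neg_nonneg.mpr (Real.log_nonpos hy.1 hy.2)
  have h := mul_le_mul_of_nonneg_left (Real.sum_le_exp_of_nonneg hlog k) hy.1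
  rw [Real.exp_neg, Real.exp_log hpos, mul_inv_cancel₀ hpos.ne'] at h
  rw [phiUF_eq]
  linarith

theorem hasDerivAt_phiUF_succ (k : ℕ) {y : ℝ} (hy : y ≠ 0) :
    HasDerivAt (phiUF (k + 1)) (-((-Real.log y) ^ k / (Nat.factorial k))) y := by
  induction k with
  | zero =>
    have h : phiUF 1 = fun y => 1 - y := by ext; simp [phiUF_eq]
    simpa [h] using (hasDerivAt_id y).const_sub 1
  | succ k ih =>
    have h : phiUF (k + 1 + 1) = fun y => phiUF (k + 1) y -
        y * ((-Real.log y) ^ (k + 1) / (Nat.factorial (k + 1))) := funext (phiUF_succ (k + 1))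
    rw [h]
    refine (ih.sub ((hasDerivAt_id' y).mul ((((Real.hasDerivAt_log hy).fun_neg).fun_pow
      (k + 1)).div_const (Nat.factorial (k + 1) : ℝ)))).congr_deriv ?_
    have hk : (Nat.factorial k : ℝ) ≠ 0 := by positivity
    have hk1 : (k : ℝ) + 1 ≠ 0 := by positivity
    simp only [Nat.factorial_succ, Nat.cast_mul, Nat.cast_add, Nat.cast_one,
      add_tsub_cancel_right]
    field_simp
    ring

theorem antitoneOn_phiUF (k : ℕ) : AntitoneOn (phiUF k) (Set.Icc 0 1) := by
  cases k with
  | zero => intro a _ b _ _; simp [phiUF_eq]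
  | succ k =>
    have h : AntitoneOn (phiUF (k + 1)) (Set.Ioc 0 1) := by
      refine antitoneOn_of_deriv_nonpos (convex_Ioc 0 1)
        (fun y hy => (hasDerivAt_phiUF_succ k hy.1.ne').continuousAt.continuousWithinAt)
        (fun y hy => ?_) (fun y hy => ?_) <;> rw [interior_Ioc] at hy
      · exact (hasDerivAt_phiUF_succ k hy.1.ne').differentiableAt.differentiableWithinAt
      · rw [(hasDerivAt_phiUF_succ k hy.1.ne').deriv]
        have := neg_nonneg.mpr (Real.log_nonpos hy.1.le hy.2.le)
        exact neg_nonpos.mpr (by positivity)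
    intro a ha b hb hab
    rcases ha.1.eq_or_lt with rfl | hpos
    · simpa [phiUF_eq (k + 1) 0] using phiUF_le_one (k + 1) hb
    · exact h ⟨hpos, ha.2⟩ ⟨hpos.trans_le hab, hb.2⟩ hab

theorem integral_pow_mul_neg_log_pow (n j : ℕ) :
    ∫ y in (0 : ℝ)..1, y ^ n * (-Real.log y) ^ j = (Nat.factorial j) / ((n : ℝ) + 1) ^ (j + 1) := by
  have himg : (fun t : ℝ => Real.exp (-t)) '' Set.Ioi 0 = Set.Ioo 0 1 := by
    ext y
    constructor
    · rintro ⟨t, ht, rfl⟩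
      exact ⟨Real.exp_pos _, Real.exp_lt_one_iff.mpr (neg_lt_zero.mpr ht)⟩
    · intro hy
      exact ⟨-Real.log y, neg_pos.mpr (Real.log_neg hy.1 hy.2), by simp [Real.exp_log hy.1]⟩
  have hderiv : ∀ t ∈ Set.Ioi (0 : ℝ), HasDerivWithinAt (fun t : ℝ => Real.exp (-t))
      (-Real.exp (-t)) (Set.Ioi 0) t := fun t _ => by
    simpa using ((hasDerivAt_neg t).exp).hasDerivWithinAt
  rw [intervalIntegral.integral_of_le zero_le_one, integral_Ioc_eq_integral_Ioo, ← himg,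
    integral_image_eq_integral_abs_deriv_smul measurableSet_Ioi hderiv
      (fun a _ b _ hab => by simpa using hab)]
  have hG := Real.integral_rpow_mul_exp_neg_mul_Ioi (a := (j : ℝ) + 1) (r := (n : ℝ) + 1)
    (by positivity) (by positivity)
  rw [Real.Gamma_nat_eq_factorial] at hG
  have hcongr : ∀ t : ℝ, |(-Real.exp (-t))| • (Real.exp (-t) ^ n * (-Real.log (Real.exp (-t))) ^ j)
      = t ^ ((j : ℝ) + 1 - 1) * Real.exp (-(((n : ℝ) + 1) * t)) := fun t => by
    rw [abs_neg, abs_of_pos (Real.exp_pos _), Real.log_exp, neg_neg, add_sub_cancel_right,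
      Real.rpow_natCast, smul_eq_mul, ← mul_assoc, ← pow_succ', ← Real.exp_nat_mul, mul_comm]
    congr 2
    push_cast
    ring
  simp_rw [hcongr]
  rw [hG, show ((j : ℝ) + 1) = ((j + 1 : ℕ) : ℝ) by push_cast; rfl, Real.rpow_natCast,
    one_div, inv_pow, mul_comm, div_eq_mul_inv]

theorem intervalIntegrable_pow_mul_neg_log_pow (n j : ℕ) :
    IntervalIntegrable (fun y : ℝ => y ^ n * (-Real.log y) ^ j) volume 0 1 := by
  by_contra h
  have h0 := integral_pow_mul_neg_log_pow n j
  rw [intervalIntegral.integral_undef h] at h0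
  have : (0 : ℝ) < (Nat.factorial j) / ((n : ℝ) + 1) ^ (j + 1) := by positivity
  linarith

theorem intervalIntegrable_pow_mul_phiUF (n k : ℕ) :
    IntervalIntegrable (fun y : ℝ => y ^ n * phiUF k y) volume 0 1 := by
  induction k with
  | zero => simp [phiUF_eq]
  | succ k ih =>
    convert ih.sub ((intervalIntegrable_pow_mul_neg_log_pow (n + 1) k).div_const
      (Nat.factorial k : ℝ)) using 1
    ext y
    simp only [phiUF_succ]
    ring

theorem integral_pow_mul_phiUF (n k : ℕ) :
    ∫ y in (0 : ℝ)..1, y ^ n * phiUF k y = 1 / (((n : ℝ) + 1) * ((n : ℝ) + 2) ^ k) := by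
  induction k with
  | zero => simp [phiUF_eq, integral_pow]
  | succ k ih =>
    have h : ∀ y : ℝ, y ^ n * phiUF (k + 1) y = y ^ n * phiUF k y -
        y ^ (n + 1) * (-Real.log y) ^ k / (Nat.factorial k) := fun y => by
      rw [phiUF_succ]
      ring
    simp_rw [h]
    rw [intervalIntegral.integral_sub (intervalIntegrable_pow_mul_phiUF n k)
      ((intervalIntegrable_pow_mul_neg_log_pow (n + 1) k).div_const _), ih,
      intervalIntegral.integral_div, integral_pow_mul_neg_log_pow]
    have hk : (Nat.factorial k : ℝ) ≠ 0 := by positivity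
    push_cast
    rw [show (n : ℝ) + 1 + 1 = n + 2 by ring]
    field_simp
    ring

theorem intervalIntegrable_and_integral_comp_abs_sub {g : ℝ → ℝ}
    (hg : IntervalIntegrable g volume 0 1) {x : ℝ} (hx : x ∈ Set.Icc (0 : ℝ) 1) :
    IntervalIntegrable (fun z => g |z - x|) volume 0 1 ∧
      ∫ z in (0 : ℝ)..1, g |z - x| = (∫ u in (0 : ℝ)..x, g u) + ∫ u in (0 : ℝ)..(1 - x), g u := by
  have hl : IntervalIntegrable (fun z => g (x - z)) volume 0 x := by
    have := (hg.mono_set (c := 0) (d := x) (by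
      rw [Set.uIcc_of_le hx.1, Set.uIcc_of_le zero_le_one]
      exact Set.Icc_subset_Icc_right hx.2)).comp_sub_left x
    simpa using this.symm
  have hr : IntervalIntegrable (fun z => g (z - x)) volume x 1 := by
    have := (hg.mono_set (c := 0) (d := 1 - x) (by
      rw [Set.uIcc_of_le (sub_nonneg.mpr hx.2), Set.uIcc_of_le zero_le_one]
      exact Set.Icc_subset_Icc_right (by linarith [hx.1]))).comp_sub_right x
    simpa using this
  have el : Set.EqOn (fun z => g (x - z)) (fun z => g |z - x|) (Set.uIcc 0 x) := fun z hz => by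
    rw [Set.uIcc_of_le hx.1] at hz
    simp only
    rw [abs_of_nonpos (by linarith [hz.2]), neg_sub]
  have er : Set.EqOn (fun z => g (z - x)) (fun z => g |z - x|) (Set.uIcc x 1) := fun z hz => by
    rw [Set.uIcc_of_le hx.2] at hz
    simp only
    rw [abs_of_nonneg (by linarith [hz.1])]
  have hl' := hl.congr (el.mono Set.uIoc_subset_uIcc)
  have hr' := hr.congr (er.mono Set.uIoc_subset_uIcc)
  refine ⟨hl'.trans hr', ?_⟩
  rw [← intervalIntegral.integral_add_adjacent_intervals hl' hr',
    ← intervalIntegral.integral_congr el, ← intervalIntegral.integral_congr er,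
    intervalIntegral.integral_comp_sub_left, intervalIntegral.integral_comp_sub_right]
  simp

theorem integral_comp_abs_sub_le {g : ℝ → ℝ} (hg : IntervalIntegrable g volume 0 1)
    (h0 : ∀ u ∈ Set.Icc (0 : ℝ) 1, 0 ≤ g u) {x : ℝ} (hx : x ∈ Set.Icc (0 : ℝ) 1) :
    ∫ z in (0 : ℝ)..1, g |z - x| ≤ 2 * ∫ u in (0 : ℝ)..1, g u := by
  have hmono : ∀ c ∈ Set.Icc (0 : ℝ) 1, ∫ u in (0 : ℝ)..c, g u ≤ ∫ u in (0 : ℝ)..1, g u :=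
    fun c hc => intervalIntegral.integral_mono_interval le_rfl hc.1 hc.2
      ((ae_restrict_iff' measurableSet_Ioc).mpr
        (.of_forall fun u hu => h0 u (Set.Ioc_subset_Icc_self hu))) hg
  rw [(intervalIntegrable_and_integral_comp_abs_sub hg hx).2]
  linarith [hmono x hx, hmono (1 - x) ⟨by linarith [hx.2], by linarith [hx.1]⟩]

theorem le_integral_comp_abs_sub {g : ℝ → ℝ} (hg : IntervalIntegrable g volume 0 1)
    (hanti : AntitoneOn g (Set.Icc 0 1)) {x : ℝ} (hx : x ∈ Set.Icc (0 : ℝ) 1) :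
    ∫ u in (0 : ℝ)..1, g u ≤ ∫ z in (0 : ℝ)..1, g |z - x| := by
  have h1 : IntervalIntegrable g volume 0 x := hg.mono_set (by
    rw [Set.uIcc_of_le hx.1, Set.uIcc_of_le zero_le_one]
    exact Set.Icc_subset_Icc_right hx.2)
  have h2 : IntervalIntegrable g volume x 1 := hg.mono_set (by
    rw [Set.uIcc_of_le hx.2, Set.uIcc_of_le zero_le_one]
    exact Set.Icc_subset_Icc_left hx.1)
  have h3 : IntervalIntegrable g volume 0 (1 - x) := hg.mono_set (by
    rw [Set.uIcc_of_le (sub_nonneg.mpr hx.2), Set.uIcc_of_le zero_le_one]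
    exact Set.Icc_subset_Icc_right (by linarith [hx.1]))
  have h4 : ∫ u in x..1, g u ≤ ∫ u in (0 : ℝ)..(1 - x), g u := by
    have h3' : IntervalIntegrable (fun z => g (z - x)) volume x 1 := by
      simpa using h3.comp_sub_right x
    calc ∫ u in x..1, g u ≤ ∫ z in x..1, g (z - x) :=
          intervalIntegral.integral_mono_on hx.2 h2 h3' fun z hz =>
            hanti ⟨by linarith [hz.1], by linarith [hz.2, hx.1]⟩
              ⟨hx.1.trans hz.1, hz.2⟩ (by linarith [hx.1])
      _ = ∫ u in (0 : ℝ)..(1 - x), g u := by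
          rw [intervalIntegral.integral_comp_sub_right]
          simp
  rw [(intervalIntegrable_and_integral_comp_abs_sub hg hx).2,
    ← intervalIntegral.integral_add_adjacent_intervals h1 h2]
  linarith

theorem sum_multinomial_mul_prod_pow (d k : ℕ) (a : Fin d → ℝ) :
    ∑ p ∈ Finset.univ.filter (fun p : Fin d → Fin (k + 1) => ∑ j, (p j : ℕ) = k),
      ((Nat.factorial k : ℝ) / ∏ j, (Nat.factorial (p j : ℕ) : ℝ)) * ∏ j, a j ^ (p j : ℕ) =
      (∑ j, a j) ^ k := by
  rw [Finset.sum_pow_eq_sum_piAntidiag]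
  refine Finset.sum_bij (fun p _ j => (p j : ℕ)) ?_ ?_ ?_ ?_
  · intro p hp
    simpa using hp
  · intro p _ q _ hpq
    ext j
    exact congrFun hpq j
  · intro q hq
    have hq' : ∑ j, q j = k := by simpa using hq
    refine ⟨fun j => ⟨q j, ?_⟩, by simpa using hq', rfl⟩
    have := Finset.single_le_sum (f := q) (fun i _ => Nat.zero_le _) (Finset.mem_univ j)
    omega
  · intro p hp
    have hp' : ∑ j, (p j : ℕ) = k := by simpa using hp
    congr 1
    have h := Nat.multinomial_spec (Finset.univ : Finset (Fin d)) (fun j => (p j : ℕ))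
    rw [hp'] at h
    rw [div_eq_iff (by positivity), ← h]
    push_cast
    ring

theorem integrable_pow_mul_phiUF_comp_abs_sub (n k : ℕ) {x : ℝ} (hx : x ∈ Set.Icc (0 : ℝ) 1) :
    Integrable (fun z => |z - x| ^ n * phiUF k |z - x|) (volume.restrict (Set.Icc (0 : ℝ) 1)) :=
  (intervalIntegrable_iff_integrableOn_Icc_of_le zero_le_one).mp
    (intervalIntegrable_and_integral_comp_abs_sub (intervalIntegrable_pow_mul_phiUF n k) hx).1

theorem integral_pow_mul_phiUF_comp_abs_sub_le (n k : ℕ) {x : ℝ} (hx : x ∈ Set.Icc (0 : ℝ) 1) :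
    ∫ z in Set.Icc (0 : ℝ) 1, |z - x| ^ n * phiUF k |z - x| ≤
      2 / ((n : ℝ) + 1) * (1 / ((n : ℝ) + 2)) ^ k := by
  rw [integral_Icc_eq_integral_Ioc, ← intervalIntegral.integral_of_le zero_le_one]
  refine (integral_comp_abs_sub_le (intervalIntegrable_pow_mul_phiUF n k)
    (fun u hu => mul_nonneg (pow_nonneg hu.1 n) (phiUF_nonneg k hu)) hx).trans_eq ?_
  rw [integral_pow_mul_phiUF, one_div_pow]
  field_simp

theorem le_integral_phiUF_comp_abs_sub (k : ℕ) {x : ℝ} (hx : x ∈ Set.Icc (0 : ℝ) 1) :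
    (1 / 2 : ℝ) ^ k ≤ ∫ z in Set.Icc (0 : ℝ) 1, phiUF k |z - x| := by
  rw [integral_Icc_eq_integral_Ioc, ← intervalIntegral.integral_of_le zero_le_one]
  have hint := intervalIntegrable_pow_mul_phiUF 0 k
  have hval := integral_pow_mul_phiUF 0 k
  simp only [pow_zero, one_mul] at hint hval
  refine le_of_eq_of_le ?_ (le_integral_comp_abs_sub hint (antitoneOn_phiUF k) hx)
  rw [hval, one_div_pow]
  norm_num

theorem volume_restrict_Icc_pi (d : ℕ) :
    (volume : Measure (Fin d → ℝ)).restrict (Set.Icc 0 1) =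
      Measure.pi fun _ => volume.restrict (Set.Icc (0 : ℝ) 1) := by
  rw [← Set.pi_univ_Icc, volume_pi]
  exact Measure.restrict_pi_pi _ _

theorem abs_sub_mem_Icc {x z : ℝ} (hx : x ∈ Set.Icc (0 : ℝ) 1) (hz : z ∈ Set.Icc (0 : ℝ) 1) :
    |z - x| ∈ Set.Icc (0 : ℝ) 1 :=
  ⟨abs_nonneg _, abs_le.mpr ⟨by linarith [hx.2, hz.1], by linarith [hx.1, hz.2]⟩⟩

theorem Kuf_nonneg (d k : ℕ) {y : Fin d → ℝ} (hy : ∀ j, y j ∈ Set.Icc (0 : ℝ) 1) :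
    0 ≤ Kuf d k y :=
  Finset.sum_nonneg fun p _ => mul_nonneg (by positivity)
    (Finset.prod_nonneg fun m _ => phiUF_nonneg _ (hy m))

/-- Weighting the kernel by powers of the coordinate distances keeps the product structure. -/
theorem integrableOn_and_integral_prod_pow_mul_Kuf (d k : ℕ) (n : Fin d → ℕ) {x : Fin d → ℝ}
    (hx : ∀ j, x j ∈ Set.Icc (0 : ℝ) 1) :
    IntegrableOn (fun z : Fin d → ℝ => (∏ m, |z m - x m| ^ n m) * Kuf d k fun j => |z j - x j|)
      (Set.Icc 0 1) ∧
    ∫ z in Set.Icc (0 : Fin d → ℝ) 1, (∏ m, |z m - x m| ^ n m) * Kuf d k (fun j => |z j - x j|) =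
      ∑ p ∈ Finset.univ.filter (fun p : Fin d → Fin (k + 1) => ∑ j, (p j : ℕ) = k),
        ((Nat.factorial k : ℝ) / ∏ j, (Nat.factorial (p j : ℕ) : ℝ)) * (1 / d) ^ k *
          ∏ m, ∫ t in Set.Icc (0 : ℝ) 1, |t - x m| ^ n m * phiUF (p m) |t - x m| := by
  have hexp : ∀ z : Fin d → ℝ, (∏ m, |z m - x m| ^ n m) * Kuf d k (fun j => |z j - x j|) =
      ∑ p ∈ Finset.univ.filter (fun p : Fin d → Fin (k + 1) => ∑ j, (p j : ℕ) = k),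
        ((Nat.factorial k : ℝ) / ∏ j, (Nat.factorial (p j : ℕ) : ℝ)) * (1 / d) ^ k *
          ∏ m, |z m - x m| ^ n m * phiUF (p m) |z m - x m| := fun z => by
    rw [Kuf, Finset.mul_sum]
    refine Finset.sum_congr rfl fun p _ => ?_
    rw [Finset.prod_mul_distrib]
    ring
  have hint : ∀ p : Fin d → Fin (k + 1), Integrable
      (fun z : Fin d → ℝ => ((Nat.factorial k : ℝ) / ∏ j, (Nat.factorial (p j : ℕ) : ℝ)) *
        (1 / d) ^ k * ∏ m, |z m - x m| ^ n m * phiUF (p m) |z m - x m|)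
      (Measure.pi fun _ => volume.restrict (Set.Icc (0 : ℝ) 1)) := fun p =>
    (Integrable.fintype_prod (f := fun m t => |t - x m| ^ n m * phiUF (p m) |t - x m|)
      fun m => integrable_pow_mul_phiUF_comp_abs_sub (n m) (p m) (hx m)).const_mul _
  simp_rw [IntegrableOn, hexp, volume_restrict_Icc_pi]
  refine ⟨integrable_finsetSum _ fun p _ => hint p, ?_⟩
  rw [integral_finsetSum _ fun p _ => hint p]
  refine Finset.sum_congr rfl fun p _ => ?_
  rw [integral_const_mul, integral_fintype_prod_eq_prod
    (fun m t => |t - x m| ^ n m * phiUF (p m) |t - x m|)]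

theorem integrableOn_Kuf (d k : ℕ) {x : Fin d → ℝ} (hx : ∀ j, x j ∈ Set.Icc (0 : ℝ) 1) :
    IntegrableOn (fun z : Fin d → ℝ => Kuf d k fun j => |z j - x j|) (Set.Icc 0 1) := by
  simpa using (integrableOn_and_integral_prod_pow_mul_Kuf d k 0 hx).1

theorem le_integral_Kuf {d : ℕ} (hd : 1 ≤ d) (k : ℕ) {x : Fin d → ℝ}
    (hx : ∀ j, x j ∈ Set.Icc (0 : ℝ) 1) :
    (1 / 2 : ℝ) ^ k ≤ ∫ z in Set.Icc (0 : Fin d → ℝ) 1, Kuf d k (fun j => |z j - x j|) := by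
  have h := (integrableOn_and_integral_prod_pow_mul_Kuf d k 0 hx).2
  simp only [Pi.zero_apply, pow_zero, Finset.prod_const_one, one_mul] at h
  have hd0 : (d : ℝ) ≠ 0 := by positivity
  rw [h]
  calc (1 / 2 : ℝ) ^ k = (1 / d) ^ k * (∑ _j : Fin d, (1 / 2 : ℝ)) ^ k := by
        rw [← mul_pow]
        simp [hd0]
    _ = ∑ p ∈ Finset.univ.filter (fun p : Fin d → Fin (k + 1) => ∑ j, (p j : ℕ) = k),
        ((Nat.factorial k : ℝ) / ∏ j, (Nat.factorial (p j : ℕ) : ℝ)) * (1 / d) ^ k *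
          ∏ m, (1 / 2 : ℝ) ^ (p m : ℕ) := by
        rw [← sum_multinomial_mul_prod_pow, Finset.mul_sum]
        exact Finset.sum_congr rfl fun p _ => by ring
    _ ≤ _ := by
        gcongr with p _ m
        exact le_integral_phiUF_comp_abs_sub (p m) (hx m)

theorem integrableOn_and_integral_abs_sub_mul_Kuf_le {d : ℕ} (hd : 1 ≤ d) (k : ℕ) {x : Fin d → ℝ}
    (hx : ∀ j, x j ∈ Set.Icc (0 : ℝ) 1) (i : Fin d) :
    IntegrableOn (fun z : Fin d → ℝ => |z i - x i| * Kuf d k fun j => |z j - x j|) (Set.Icc 0 1) ∧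
    ∫ z in Set.Icc (0 : Fin d → ℝ) 1, |z i - x i| * Kuf d k (fun j => |z j - x j|) ≤
      2 ^ d / 2 * ((1 / 2) ^ k * (1 - 1 / (3 * d)) ^ k) := by
  have hd0 : (d : ℝ) ≠ 0 := by positivity
  have hprod : ∀ z : Fin d → ℝ, ∏ m, |z m - x m| ^ (Pi.single i 1 : Fin d → ℕ) m = |z i - x i| :=
    fun z => by
      rw [Finset.prod_eq_single i (fun m _ hm => by simp [hm]) (by simp)]
      simp
  have h := integrableOn_and_integral_prod_pow_mul_Kuf d k (Pi.single i 1) hx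
  simp_rw [hprod] at h
  refine ⟨h.1, ?_⟩
  rw [h.2]
  set b : Fin d → ℝ := fun m => 2 / (((Pi.single i 1 : Fin d → ℕ) m : ℝ) + 1) with hb
  set a : Fin d → ℝ := fun m => 1 / (((Pi.single i 1 : Fin d → ℕ) m : ℝ) + 2) with ha
  have hbprod : ∏ m, b m = 2 ^ d / 2 := by
    have hm : ∀ m ∈ Finset.univ.erase i, b m = 2 := fun m hm => by
      simp [hb, Finset.ne_of_mem_erase hm]
    rw [← Finset.mul_prod_erase _ _ (Finset.mem_univ i), Finset.prod_congr rfl hm]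
    obtain ⟨e, rfl⟩ := Nat.exists_eq_add_of_le' hd
    simp [hb, pow_succ]
    norm_num
  have hasum : ∑ m, a m = d / 2 - 1 / 6 := by
    have hm : ∀ m ∈ Finset.univ.erase i, a m = 1 / 2 := fun m hm => by
      simp [ha, Finset.ne_of_mem_erase hm]
    rw [← Finset.add_sum_erase _ _ (Finset.mem_univ i), Finset.sum_congr rfl hm]
    obtain ⟨e, rfl⟩ := Nat.exists_eq_add_of_le' hd
    simp [ha]
    ring
  calc _ ≤ ∑ p ∈ Finset.univ.filter (fun p : Fin d → Fin (k + 1) => ∑ j, (p j : ℕ) = k),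
        ((Nat.factorial k : ℝ) / ∏ j, (Nat.factorial (p j : ℕ) : ℝ)) * (1 / d) ^ k *
          ∏ m, b m * a m ^ (p m : ℕ) := by
        gcongr with p _ m
        · intro m _
          exact setIntegral_nonneg measurableSet_Icc fun t ht => mul_nonneg (by positivity)
            (phiUF_nonneg _ (abs_sub_mem_Icc (hx m) ht))
        · exact integral_pow_mul_phiUF_comp_abs_sub_le _ (p m) (hx m)
    _ = (∏ m, b m) * ((1 / d) ^ k * (∑ m, a m) ^ k) := by
        rw [← sum_multinomial_mul_prod_pow, Finset.mul_sum, Finset.mul_sum]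
        refine Finset.sum_congr rfl fun p _ => ?_
        rw [Finset.prod_mul_distrib]
        ring
    _ = _ := by
        rw [hbprod, hasum, ← mul_pow, ← mul_pow]
        congr 2
        field_simp
        ring

/-- Bias bound for the (translation-invariant) infinite uniform KeRF: if `f` is
`L`-Lipschitz on `[0,1]^d`, then the normalized kernel average of `f` at `x` deviates
from `f x` by at most `(L d 2^{2d+1}/3) (1 - 1/(3d))^k`. -/
theorem uniform_kerf_bias (d k : ℕ) (hd : 1 ≤ d) (L : ℝ) (hL : 0 < L)
    (f : (Fin d → ℝ) → ℝ)
    (hf : LipschitzOnWith (Real.toNNReal L) f (Set.Icc (0 : Fin d → ℝ) 1))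
    (x : Fin d → ℝ) (hx : ∀ j, x j ∈ Set.Icc (0 : ℝ) 1) :
    |(∫ z in Set.Icc (0 : Fin d → ℝ) 1, Kuf d k (fun j => |z j - x j|) * f z) /
        (∫ z in Set.Icc (0 : Fin d → ℝ) 1, Kuf d k (fun j => |z j - x j|)) - f x|
      ≤ (L * d * 2 ^ (2 * d + 1) / 3) * (1 - 1 / (3 * d)) ^ k := by
  have hxm : x ∈ Set.Icc (0 : Fin d → ℝ) 1 := ⟨fun j => (hx j).1, fun j => (hx j).2⟩
  have hK := integrableOn_Kuf d k hx
  have hKf := hK.mul_continuousOn hf.continuousOn isCompact_Icc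
  have hD := le_integral_Kuf hd k hx
  set D := ∫ z in Set.Icc (0 : Fin d → ℝ) 1, Kuf d k (fun j => |z j - x j|)
  have hDpos : 0 < D := lt_of_lt_of_le (by positivity) hD
  have hd1 : (1 : ℝ) ≤ d := by exact_mod_cast hd
  have hr : 0 ≤ 1 - 1 / (3 * (d : ℝ)) := by
    rw [sub_nonneg, div_le_one (by positivity)]
    linarith
  have hlip : ∀ z ∈ Set.Icc (0 : Fin d → ℝ) 1, |f z - f x| ≤ L * ∑ i, |z i - x i| := fun z hz => by
    have h := hf.dist_le_mul z hz x hxm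
    rw [Real.dist_eq, Real.coe_toNNReal L hL.le] at h
    refine h.trans (mul_le_mul_of_nonneg_left ?_ hL.le)
    rw [dist_pi_le_iff (Finset.sum_nonneg fun i _ => abs_nonneg _)]
    exact fun i => Finset.single_le_sum (f := fun i => |z i - x i|)
      (fun i _ => abs_nonneg _) (Finset.mem_univ i)
  have hdom : IntegrableOn (fun z : Fin d → ℝ => L * ∑ i, |z i - x i| * Kuf d k fun j => |z j - x j|)
      (Set.Icc 0 1) :=
    (integrable_finsetSum _ fun i _ => (integrableOn_and_integral_abs_sub_mul_Kuf_le hd k hx i).1).const_mul L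
  have hnum : |(∫ z in Set.Icc (0 : Fin d → ℝ) 1, Kuf d k (fun j => |z j - x j|) * f z) - f x * D|
      ≤ L * (d * (2 ^ d / 2 * ((1 / 2) ^ k * (1 - 1 / (3 * d)) ^ k))) := by
    rw [mul_comm (f x), ← integral_mul_const, ← integral_sub hKf (hK.mul_const _)]
    calc _ ≤ ∫ z in Set.Icc (0 : Fin d → ℝ) 1,
          L * ∑ i, |z i - x i| * Kuf d k (fun j => |z j - x j|) := by
          rw [← Real.norm_eq_abs]
          refine norm_integral_le_of_norm_le hdom ((ae_restrict_iff' measurableSet_Icc).mpr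
            (.of_forall fun z hz => ?_))
          have hK0 : 0 ≤ Kuf d k (fun j => |z j - x j|) :=
            Kuf_nonneg d k fun j => abs_sub_mem_Icc (hx j) ⟨hz.1 j, hz.2 j⟩
          rw [← mul_sub, Real.norm_eq_abs, abs_mul, abs_of_nonneg hK0, ← Finset.sum_mul,
            ← mul_assoc, mul_comm]
          exact mul_le_mul_of_nonneg_right (hlip z hz) hK0
      _ ≤ _ := by
          rw [integral_const_mul,
            integral_finsetSum _ fun i _ => (integrableOn_and_integral_abs_sub_mul_Kuf_le hd k hx i).1]
          refine mul_le_mul_of_nonneg_left ?_ hL.le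
          refine (Finset.sum_le_sum fun i _ =>
            (integrableOn_and_integral_abs_sub_mul_Kuf_le hd k hx i).2).trans_eq ?_
          simp
  have hpow : (2 : ℝ) ^ d / 2 ≤ 2 ^ (2 * d + 1) / 3 := by
    have h : (1 : ℝ) ≤ 2 ^ d := one_le_pow₀ one_le_two
    rw [pow_succ, two_mul, pow_add]
    nlinarith
  rw [div_sub' hDpos.ne', abs_div, abs_of_pos hDpos, div_le_iff₀ hDpos, mul_comm D]
  calc _ ≤ _ := hnum
    _ = L * d * (2 ^ d / 2) * (1 - 1 / (3 * d)) ^ k * (1 / 2) ^ k := by ring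
    _ ≤ L * d * (2 ^ (2 * d + 1) / 3) * (1 - 1 / (3 * d)) ^ k * D := by gcongr
    _ = _ := by ring
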